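/- arXiv:math/0303281 — 2 statements merged into one kernel-verified Lean document; each statement's English description precedes it below -/
import Mathlib

section
/- Let Θ ⊆ I. The multiplication map W^{Θ∪Θ^⊥} × W_{Θ^⊥} → W, (a,b) ↦ ab, is injective and its image is exactly W^Θ. Likewise, the multiplication map W_{Θ^⊥} × ^{Θ∪Θ^⊥}W → W, (b,c) ↦ bc, is injective and its image is exactly ^ΘW. -/
open Classical

namespace Paper

variable {B : Type*} {M : CoxeterMatrix B} {W : Type*} [Group W]

/-- `Θ^⊥`: the indices whose simple reflections commute with all simple
reflections indexed by `Θ` (i.e. `m(i,j) = 2` for all `j ∈ Θ`). -/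
def perp (M : CoxeterMatrix B) (Θ : Set B) : Set B := {i | i ∉ Θ ∧ ∀ j ∈ Θ, M i j = 2}

variable (cs : CoxeterSystem M W)

/-- The standard parabolic subgroup `W_J` generated by the simple reflections indexed by `J`. -/
def parabolic (J : Set B) : Subgroup W := Subgroup.closure (cs.simple '' J)

/-- `W^J`: the minimal-length representatives of the cosets `W/W_J`,
`{w : ℓ(wu) = ℓ(w) + ℓ(u) for all u ∈ W_J}`. -/
def minRight (J : Set B) : Set W :=
  {w | ∀ u ∈ parabolic cs J, cs.length (w * u) = cs.length w + cs.length u}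

/-- `^JW`: the minimal-length representatives of the cosets `W_J\W`,
`{w : ℓ(uw) = ℓ(u) + ℓ(w) for all u ∈ W_J}`. -/
def minLeft (J : Set B) : Set W :=
  {w | ∀ u ∈ parabolic cs J, cs.length (u * w) = cs.length u + cs.length w}

/-- The Bruhat order on `W`: `x ≤ y` iff `y` is obtained from `x` by a chain of
right multiplications by reflections, each strictly increasing the length. -/
def bruhatLE : W → W → Prop :=
  Relation.ReflTransGen (fun x y => ∃ t, cs.IsReflection t ∧ y = x * t ∧ cs.length x < cs.length y)

/-- The equivalence relation `∼_Θ` on `W × W`: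
`(x,y) ∼_Θ (x',y')` iff there are `u ∈ W_{Θ∪Θ^⊥}` and `v ∈ W_Θ` with `x' = xu`, `y' = u⁻¹vy`. -/
def simRel (Θ : Set B) (p q : W × W) : Prop :=
  ∃ u ∈ parabolic cs (Θ ∪ perp M Θ), ∃ v ∈ parabolic cs Θ,
    q.1 = p.1 * u ∧ q.2 = u⁻¹ * v * p.2

/-- `w^J`: the minimal-length element of the coset `w W_J`. -/
noncomputable def projR (J : Set B) (w : W) : W :=
  if h : ∃ a, a ∈ minRight cs J ∧ a⁻¹ * w ∈ parabolic cs J then h.choose else w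

/-- `^Jw`: the minimal-length element of the coset `W_J w`. -/
noncomputable def projL (J : Set B) (w : W) : W :=
  if h : ∃ a, a ∈ minLeft cs J ∧ w * a⁻¹ ∈ parabolic cs J then h.choose else w

/-! ### Injectivity of the simple reflections, via the geometric representation -/

/-- The linear form `v ↦ 2 B(α_i, v)` of the geometric representation. -/
noncomputable def simpleCoroot (M : CoxeterMatrix B) (i : B) : Module.Dual ℝ (B →₀ ℝ) :=
  Finsupp.linearCombination ℝ fun j => -2 * Real.cos (Real.pi / M i j)

lemma simpleCoroot_single (M : CoxeterMatrix B) (i j : B) :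
    simpleCoroot M i (Finsupp.single j 1) = -2 * Real.cos (Real.pi / M i j) := by
  simp [simpleCoroot]

lemma simpleCoroot_single_self (M : CoxeterMatrix B) (i : B) :
    simpleCoroot M i (Finsupp.single i 1) = 2 := by
  simp [simpleCoroot_single]

/-- The reflection of the geometric representation attached to an index. -/
noncomputable def geomReflection (M : CoxeterMatrix B) (i : B) :
    (B →₀ ℝ) ≃ₗ[ℝ] (B →₀ ℝ) :=
  Module.reflection (simpleCoroot_single_self M i)

lemma sin_two_mul_pi_div_pos {m : ℕ} (hm : 3 ≤ m) : 0 < Real.sin (2 * (Real.pi / m)) := by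
  have hm' : (3 : ℝ) ≤ m := by exact_mod_cast hm
  apply Real.sin_pos_of_pos_of_lt_pi (by positivity)
  rw [← mul_div_assoc, div_lt_iff₀ (by positivity)]
  nlinarith [Real.pi_pos]

lemma chebyshevS_eval_two_mul_cos_eq_zero {m : ℕ} (hm : 3 ≤ m) {n : ℤ} (hn : 2 * (n + 1) = m) :
    (Polynomial.Chebyshev.S ℝ n).eval (2 * Real.cos (2 * (Real.pi / m))) = 0 := by
  have h := Polynomial.Chebyshev.S_two_mul_real_cos (2 * (Real.pi / m)) n
  have hn' : (2 : ℝ) * (n + 1) = m := by exact_mod_cast hn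
  have hπ : (m : ℝ) * (Real.pi / m) = Real.pi :=
    mul_div_cancel₀ _ (Nat.cast_ne_zero.mpr (by omega))
  rw [show ((n : ℝ) + 1) * (2 * (Real.pi / m)) = Real.pi by
    linear_combination (Real.pi / m) * hn' + hπ, Real.sin_pi] at h
  exact (mul_eq_zero.mp h).resolve_right (sin_two_mul_pi_div_pos hm).ne'

lemma chebyshevS_add_eval_two_mul_cos_eq_zero {m : ℕ} (hm : 3 ≤ m) {n : ℤ}
    (hn : 2 * n + 1 = m) :
    (Polynomial.Chebyshev.S ℝ n).eval (2 * Real.cos (2 * (Real.pi / m))) +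
      (Polynomial.Chebyshev.S ℝ (n - 1)).eval (2 * Real.cos (2 * (Real.pi / m))) = 0 := by
  have h₁ := Polynomial.Chebyshev.S_two_mul_real_cos (2 * (Real.pi / m)) n
  have h₂ := Polynomial.Chebyshev.S_two_mul_real_cos (2 * (Real.pi / m)) (n - 1)
  have hn' : (2 : ℝ) * n = m - 1 := by
    have : (2 : ℝ) * n + 1 = m := by exact_mod_cast hn
    linarith
  have hπ : (m : ℝ) * (Real.pi / m) = Real.pi :=
    mul_div_cancel₀ _ (Nat.cast_ne_zero.mpr (by omega))
  rw [show ((n : ℝ) + 1) * (2 * (Real.pi / m)) = Real.pi / m + Real.pi by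
    linear_combination (Real.pi / m) * hn' + hπ, Real.sin_add_pi] at h₁
  rw [show (((n - 1 : ℤ) : ℝ) + 1) * (2 * (Real.pi / m)) = Real.pi - Real.pi / m by
    push_cast; linear_combination (Real.pi / m) * hn' + hπ, Real.sin_pi_sub] at h₂
  refine (mul_eq_zero.mp ?_).resolve_right (sin_two_mul_pi_div_pos hm).ne'
  linear_combination h₁ + h₂

lemma isLiftable_geomReflection (M : CoxeterMatrix B) : M.IsLiftable (geomReflection M) := by
  intro i j
  rcases eq_or_ne i j with rfl | hij
  · rw [M.diagonal, pow_one]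
    ext1 v
    exact Module.involutive_reflection (simpleCoroot_single_self M i) v
  have hone := M.off_diagonal i j hij
  have h₁ := simpleCoroot_single M i j
  have h₂ := simpleCoroot_single M j i
  rw [M.symmetric j i] at h₂
  generalize M i j = m at *
  ext1 v
  rw [geomReflection, geomReflection, Module.reflection_mul_reflection_pow_apply _ _ _ _
    (2 * Real.cos (2 * (Real.pi / m))) (by rw [h₁, h₂, Real.cos_two_mul]; ring)]
  obtain rfl | rfl | hm : m = 0 ∨ m = 2 ∨ 3 ≤ m := by omega
  · simp
  · norm_num at h₁ h₂
    have hcos : Real.cos (2 * (Real.pi / (2 : ℕ))) = -1 := by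
      rw [Nat.cast_ofNat, mul_div_cancel₀ _ two_ne_zero, Real.cos_pi]
    simp only [h₁, h₂, hcos]
    norm_num
    abel
  · rcases Nat.even_or_odd' m with ⟨k, hk | hk⟩
    · have e₁ : ((m : ℤ) - 2) / 2 = k - 1 := by omega
      have e₂ : ((m : ℤ) - 1) / 2 = k - 1 := by omega
      rw [e₁, e₂, chebyshevS_eval_two_mul_cos_eq_zero hm (by omega)]
      simp
    · have e₁ : ((m : ℤ) - 2) / 2 = k - 1 := by omega
      have e₂ : ((m : ℤ) - 1) / 2 = k := by omega
      have e₃ : ((m : ℤ) - 3) / 2 = k - 1 := by omega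
      have e₄ : (m : ℤ) / 2 = k := by omega
      rw [e₁, e₂, e₃, e₄, chebyshevS_add_eval_two_mul_cos_eq_zero hm (by omega)]
      simp

lemma simple_injective : Function.Injective cs.simple := by
  intro i j h
  by_contra hij
  have hrefl : geomReflection M i = geomReflection M j := by
    rw [← cs.lift_apply_simple (isLiftable_geomReflection M) i,
      ← cs.lift_apply_simple (isLiftable_geomReflection M) j, h]
  have hi := congrArg (fun f => f (Finsupp.single i 1) i) hrefl
  simp [geomReflection, Module.reflection_apply, Ne.symm hij] at hi
  norm_num at hi

/-! ### The exchange property -/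

/-- The action of a simple reflection on pairs `(t, ε)`: conjugate `t`, and flip the sign `ε`
when `t` is the reflection itself. -/
noncomputable def signedConj (i : B) : Function.End (W × ZMod 2) := fun p =>
  (cs.simple i * p.1 * cs.simple i, p.2 + if p.1 = cs.simple i then 1 else 0)

lemma signedConj_mul_pow_apply (i j : B) (k : ℕ) (p : W × ZMod 2) :
    ((signedConj cs i * signedConj cs j) ^ k) p =
      ((cs.simple i * cs.simple j) ^ k * p.1 * ((cs.simple i * cs.simple j) ^ k)⁻¹,
        p.2 + ∑ n ∈ Finset.range (2 * k),
          if p.1 = cs.simple j * (cs.simple i * cs.simple j) ^ n then 1 else 0) := by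
  induction k with
  | zero => simp; rfl
  | succ k ih =>
    set r := cs.simple i * cs.simple j with hr
    have hinv : cs.simple j * r * cs.simple j = r⁻¹ := by simp [hr, mul_assoc]
    have hpow (n : ℕ) : cs.simple j * r ^ n = (r ^ n)⁻¹ * cs.simple j := by
      have h := conj_pow (i := n) (a := cs.simple j) (b := r)
      rw [cs.inv_simple, hinv, inv_pow] at h
      rw [h, cs.simple_mul_simple_cancel_right]
    have hcond₁ : r ^ k * p.1 * (r ^ k)⁻¹ = cs.simple j ↔
        p.1 = cs.simple j * r ^ (2 * k) := by
      rw [two_mul, pow_add, ← mul_assoc, hpow, mul_inv_eq_iff_eq_mul, mul_assoc, eq_inv_mul_iff_mul_eq]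
    have hcond₂ : cs.simple j * (r ^ k * p.1 * (r ^ k)⁻¹) * cs.simple j = cs.simple i ↔
        p.1 = cs.simple j * r ^ (2 * k + 1) := by
      have : cs.simple j * r ^ (2 * k + 1) = (r ^ k)⁻¹ * (cs.simple j * r) * r ^ k := by
        rw [show 2 * k + 1 = k + (1 + k) by omega, pow_add, pow_add, pow_one, ← mul_assoc, hpow]
        simp only [mul_assoc]
      rw [this, ← mul_inv_eq_iff_eq_mul, eq_inv_mul_iff_mul_eq, ← mul_assoc,
        ← mul_left_inj (cs.simple j), cs.simple_mul_simple_cancel_right,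
        ← mul_right_inj (cs.simple j), ← hr]
      simp [mul_assoc]
    rw [pow_succ']
    change signedConj cs i (signedConj cs j (((signedConj cs i * signedConj cs j) ^ k) p)) = _
    rw [ih]
    simp only [signedConj, hcond₁, hcond₂]
    rw [show 2 * (k + 1) = 2 * k + 1 + 1 by ring, Finset.sum_range_succ, Finset.sum_range_succ,
      pow_succ' r k]
    refine Prod.ext ?_ ?_
    · rw [hr]
      simp only [mul_inv_rev, cs.inv_simple, mul_assoc]
    · simp only [add_assoc]

lemma isLiftable_signedConj : M.IsLiftable (signedConj cs) := by
  intro i j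
  funext p
  rw [signedConj_mul_pow_apply, cs.simple_mul_simple_pow, two_mul, Finset.sum_range_add]
  simp only [pow_add, cs.simple_mul_simple_pow, one_mul, CharTwo.add_self_eq_zero]
  simp
  rfl

lemma lift_signedConj_wordProd (ω : List B) (p : W × ZMod 2) :
    cs.lift ⟨signedConj cs, isLiftable_signedConj cs⟩ (cs.wordProd ω) p =
      (cs.wordProd ω * p.1 * (cs.wordProd ω)⁻¹, p.2 + ((cs.rightInvSeq ω).count p.1 : ℕ)) := by
  induction ω with
  | nil => simp; rfl
  | cons i ω ih =>
    rw [cs.wordProd_cons, map_mul, cs.lift_apply_simple]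
    change signedConj cs i (cs.lift ⟨signedConj cs, isLiftable_signedConj cs⟩ _ p) = _
    rw [ih]
    have hcond : cs.wordProd ω * p.1 * (cs.wordProd ω)⁻¹ = cs.simple i ↔
        (cs.wordProd ω)⁻¹ * cs.simple i * cs.wordProd ω = p.1 := by
      rw [mul_inv_eq_iff_eq_mul, mul_assoc, inv_mul_eq_iff_eq_mul, eq_comm]
    simp only [signedConj, hcond, CoxeterSystem.rightInvSeq, List.count_cons, beq_iff_eq]
    refine Prod.ext ?_ ?_
    · simp [mul_assoc]
    · push_cast
      simp only [add_assoc]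

/-- The exchange property: a right descent of a word is obtained by deleting one letter. -/
lemma exists_eraseIdx_of_isRightDescent {ω : List B} {i : B}
    (h : cs.IsRightDescent (cs.wordProd ω) i) :
    ∃ k < ω.length, cs.wordProd ω * cs.simple i = cs.wordProd (ω.eraseIdx k) := by
  obtain ⟨ρ, hρ, hρω⟩ := cs.exists_isReduced (cs.wordProd ω * cs.simple i)
  have hprod : cs.wordProd (ρ.concat i) = cs.wordProd ω := by
    rw [cs.wordProd_concat, ← hρω, cs.simple_mul_simple_cancel_right]
  have hred : cs.IsReduced (ρ.concat i) := by
    have h₁ := hρ.eq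
    have h₂ := cs.isRightDescent_iff.mp h
    rw [CoxeterSystem.IsReduced, hprod, List.length_concat, ← h₁, ← hρω, h₂]
  have hcount : (cs.rightInvSeq (ρ.concat i)).count (cs.simple i) = 1 :=
    List.count_eq_one_of_mem hred.nodup_rightInvSeq (by rw [cs.rightInvSeq_concat]; simp)
  have h₁ := lift_signedConj_wordProd cs ω (cs.simple i, 0)
  have h₂ := lift_signedConj_wordProd cs (ρ.concat i) (cs.simple i, 0)
  rw [hprod, h₁, hcount] at h₂
  have hmem : cs.simple i ∈ cs.rightInvSeq ω := by
    by_contra hnot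
    have := congrArg Prod.snd h₂
    simp [List.count_eq_zero_of_not_mem hnot] at this
  obtain ⟨k, hk, hki⟩ := List.getElem_of_mem hmem
  refine ⟨k, by simpa using hk, ?_⟩
  rw [← cs.wordProd_mul_getD_rightInvSeq, List.getD_eq_getElem _ _ hk, hki]

/-! ### Standard parabolic subgroups -/

lemma wordProd_mem_parabolic {J : Set B} {ω : List B} (h : ∀ i ∈ ω, i ∈ J) :
    cs.wordProd ω ∈ parabolic cs J := by
  refine Subgroup.list_prod_mem _ fun x hx => ?_
  obtain ⟨i, hi, rfl⟩ := List.mem_map.mp hx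
  exact Subgroup.subset_closure ⟨i, h i hi, rfl⟩

lemma simple_mem_parabolic {J : Set B} {i : B} (h : i ∈ J) : cs.simple i ∈ parabolic cs J :=
  Subgroup.subset_closure ⟨i, h, rfl⟩

lemma parabolic_mono {J K : Set B} (h : J ⊆ K) : parabolic cs J ≤ parabolic cs K :=
  Subgroup.closure_mono (Set.image_mono h)

lemma exists_word_of_mem_parabolic {J : Set B} {u : W} (hu : u ∈ parabolic cs J) :
    ∃ ω : List B, (∀ i ∈ ω, i ∈ J) ∧ cs.wordProd ω = u := by
  induction hu using Subgroup.closure_induction with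
  | mem x hx =>
    obtain ⟨i, hi, rfl⟩ := hx
    exact ⟨[i], by simpa using hi, by simp⟩
  | one => exact ⟨[], by simp, by simp⟩
  | mul x y _ _ hx hy =>
    obtain ⟨ω, hω, rfl⟩ := hx
    obtain ⟨ρ, hρ, rfl⟩ := hy
    exact ⟨ω ++ ρ, by simpa [or_imp, forall_and] using ⟨hω, hρ⟩, cs.wordProd_append _ _⟩
  | inv x _ hx =>
    obtain ⟨ω, hω, rfl⟩ := hx
    exact ⟨ω.reverse, by simpa using hω, cs.wordProd_reverse _⟩

lemma exists_minimal_word_of_mem_parabolic {J : Set B} {u : W} (hu : u ∈ parabolic cs J) :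
    ∃ ω : List B, (∀ i ∈ ω, i ∈ J) ∧ cs.wordProd ω = u ∧
      ∀ ρ : List B, (∀ i ∈ ρ, i ∈ J) → cs.wordProd ρ = u → ω.length ≤ ρ.length := by
  obtain ⟨ω, ⟨hω, hu⟩, hmin⟩ := exists_minimalFor_of_wellFoundedLT
    (fun ω : List B => (∀ i ∈ ω, i ∈ J) ∧ cs.wordProd ω = u) List.length
    (exists_word_of_mem_parabolic cs hu)
  exact ⟨ω, hω, hu, fun ρ hρ hρu => (le_total _ _).elim id (hmin ⟨hρ, hρu⟩)⟩

/-- A minimal-length element `x` of `x W_J` multiplies length-additively with any word in `J`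
that is as short as possible among words in `J`. -/
lemma length_mul_wordProd_of_minimal {J : Set B} {x : W}
    (hx : ∀ u ∈ parabolic cs J, cs.length x ≤ cs.length (x * u)) {ω : List B}
    (hω : ∀ i ∈ ω, i ∈ J)
    (hmin : ∀ ρ : List B, (∀ i ∈ ρ, i ∈ J) → cs.wordProd ρ = cs.wordProd ω →
      ω.length ≤ ρ.length) :
    cs.length (x * cs.wordProd ω) = cs.length x + ω.length := by
  induction ω using List.reverseRecOn with
  | nil => simp
  | append_singleton ω i ih =>
    have hωJ : ∀ j ∈ ω, j ∈ J := fun j hj => hω j (by simp [hj])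
    have hi : i ∈ J := hω i (by simp)
    have hlen := ih hωJ fun ρ hρ h => by
      have := hmin (ρ ++ [i]) (by simpa [or_imp, forall_and] using ⟨hρ, hi⟩)
        (by rw [cs.wordProd_append, cs.wordProd_append, h])
      simpa using this
    rw [cs.wordProd_append, cs.wordProd_singleton, ← mul_assoc, List.length_append,
      List.length_singleton, ← add_assoc, ← hlen, ← cs.not_isRightDescent_iff]
    intro hdesc
    obtain ⟨ρ, hρ, rfl⟩ := cs.exists_isReduced x
    rw [← cs.wordProd_append] at hdesc
    obtain ⟨k, hk, hkω⟩ := exists_eraseIdx_of_isRightDescent cs hdesc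
    rcases lt_or_ge k ρ.length with hkρ | hkρ
    · rw [List.eraseIdx_append_of_lt_length hkρ, cs.wordProd_append, cs.wordProd_append] at hkω
      have hu : cs.wordProd ω * cs.simple i * (cs.wordProd ω)⁻¹ ∈ parabolic cs J :=
        mul_mem (mul_mem (wordProd_mem_parabolic cs hωJ) (simple_mem_parabolic cs hi))
          (inv_mem (wordProd_mem_parabolic cs hωJ))
      have hle := hx _ hu
      rw [← mul_assoc, ← mul_assoc, hkω, mul_inv_cancel_right, hρ.eq] at hle
      have := cs.length_wordProd_le (ρ.eraseIdx k)
      rw [List.length_eraseIdx_of_lt hkρ] at this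
      omega
    · rw [List.eraseIdx_append_of_length_le hkρ, cs.wordProd_append, cs.wordProd_append, mul_assoc,
        mul_right_inj] at hkω
      have := hmin (ω.eraseIdx (k - ρ.length)) (fun j hj => hωJ j (List.mem_of_mem_eraseIdx hj))
        (by rw [← hkω, cs.wordProd_append, cs.wordProd_singleton])
      have hle := List.length_eraseIdx_le ω (k - ρ.length)
      rw [List.length_append, List.length_singleton] at this
      omega

lemma exists_isReduced_of_mem_parabolic {J : Set B} {u : W} (hu : u ∈ parabolic cs J) :
    ∃ ω : List B, (∀ i ∈ ω, i ∈ J) ∧ cs.IsReduced ω ∧ cs.wordProd ω = u := by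
  obtain ⟨ω, hω, rfl, hmin⟩ := exists_minimal_word_of_mem_parabolic cs hu
  have := length_mul_wordProd_of_minimal cs (x := 1) (by simp) hω hmin
  exact ⟨ω, hω, by simpa [CoxeterSystem.IsReduced] using this, rfl⟩

lemma mem_minRight_of_length_le {J : Set B} {x : W}
    (hx : ∀ u ∈ parabolic cs J, cs.length x ≤ cs.length (x * u)) : x ∈ minRight cs J := by
  intro u hu
  obtain ⟨ω, hω, rfl, hmin⟩ := exists_minimal_word_of_mem_parabolic cs hu
  have hone := length_mul_wordProd_of_minimal cs (x := 1) (by simp) hω hmin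
  rw [length_mul_wordProd_of_minimal cs hx hω hmin]
  simpa using hone.symm

lemma exists_minRight_mul_parabolic (J : Set B) (w : W) :
    ∃ a ∈ minRight cs J, ∃ u ∈ parabolic cs J, a * u = w := by
  obtain ⟨u, hu, hmin⟩ := exists_minimalFor_of_wellFoundedLT (· ∈ parabolic cs J)
    (fun u => cs.length (w * u)) ⟨1, one_mem _⟩
  refine ⟨w * u, mem_minRight_of_length_le cs fun v hv => ?_, u⁻¹, inv_mem hu, by simp⟩
  rw [mul_assoc]
  exact (le_total _ _).elim id (hmin (mul_mem hu hv))

lemma mem_of_simple_mem_parabolic {J : Set B} {i : B} (h : cs.simple i ∈ parabolic cs J) :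
    i ∈ J := by
  obtain ⟨ω, hω, hred, hi⟩ := exists_isReduced_of_mem_parabolic cs h
  have hlen := hred.eq
  rw [hi, cs.length_simple] at hlen
  obtain ⟨j, rfl⟩ := List.length_eq_one_iff.mp hlen.symm
  rw [cs.wordProd_singleton] at hi
  exact simple_injective cs hi ▸ hω j (by simp)

lemma mem_minRight_of_not_isRightDescent {J : Set B} {w : W}
    (h : ∀ i ∈ J, ¬ cs.IsRightDescent w i) : w ∈ minRight cs J := by
  obtain ⟨a, ha, u, hu, rfl⟩ := exists_minRight_mul_parabolic cs J w
  obtain ⟨ω, hω, hred, rfl⟩ := exists_isReduced_of_mem_parabolic cs hu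
  rcases List.eq_nil_or_concat' ω with rfl | ⟨ρ, i, rfl⟩
  · simpa using ha
  have hi : i ∈ J := hω i (by simp)
  have hρ : ∀ j ∈ ρ, j ∈ J := fun j hj => hω j (by simp [hj])
  refine absurd ?_ (h i hi)
  have hlen := ha _ (wordProd_mem_parabolic cs hρ)
  have hle := cs.length_wordProd_le ρ
  rw [CoxeterSystem.IsRightDescent, ha _ hu, hred.eq, mul_assoc, cs.wordProd_append,
    cs.wordProd_singleton, cs.simple_mul_simple_cancel_right, hlen, List.length_append,
    List.length_singleton]
  omega

lemma parabolic_subset_minRight_of_disjoint {J K : Set B} (h : Disjoint J K) :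
    (parabolic cs J : Set W) ⊆ minRight cs K := by
  intro b hb
  refine mem_minRight_of_not_isRightDescent cs fun i hi hdesc => ?_
  obtain ⟨ω, hω, rfl⟩ := exists_word_of_mem_parabolic cs hb
  obtain ⟨k, -, hk⟩ := exists_eraseIdx_of_isRightDescent cs hdesc
  have hmem : cs.wordProd ω * cs.simple i ∈ parabolic cs J :=
    hk ▸ wordProd_mem_parabolic cs fun j hj => hω j (List.mem_of_mem_eraseIdx hj)
  exact Set.disjoint_left.mp h
    (mem_of_simple_mem_parabolic cs ((Subgroup.mul_mem_cancel_left _ hb).mp hmem)) hi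

lemma disjoint_perp (M : CoxeterMatrix B) (Θ : Set B) : Disjoint (perp M Θ) Θ :=
  Set.disjoint_left.mpr fun _ h => h.1

lemma simple_commute {i j : B} (h : M i j = 2) : Commute (cs.simple i) (cs.simple j) := by
  have hpow := cs.simple_mul_simple_pow i j
  rw [h, pow_two, mul_eq_one_iff_eq_inv, mul_inv_rev, cs.inv_simple, cs.inv_simple] at hpow
  exact hpow

lemma parabolic_union_perp (Θ : Set B) :
    parabolic cs (Θ ∪ perp M Θ) = parabolic cs (perp M Θ) ⊔ parabolic cs Θ := by
  rw [parabolic, Set.image_union, Subgroup.closure_union, sup_comm]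
  rfl

lemma parabolic_perp_le_centralizer (Θ : Set B) :
    parabolic cs (perp M Θ) ≤ Subgroup.centralizer (parabolic cs Θ : Set W) := by
  rw [parabolic, parabolic, Subgroup.centralizer_closure, Subgroup.closure_le]
  rintro _ ⟨i, hi, rfl⟩
  rw [SetLike.mem_coe, Subgroup.mem_centralizer_iff]
  rintro _ ⟨j, hj, rfl⟩
  exact (simple_commute cs (hi.2 j hj)).symm

lemma exists_mul_of_mem_parabolic_union_perp {Θ : Set B} {k : W}
    (hk : k ∈ parabolic cs (Θ ∪ perp M Θ)) :
    ∃ b ∈ parabolic cs (perp M Θ), ∃ u ∈ parabolic cs Θ, b * u = k := by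
  rw [parabolic_union_perp, ← SetLike.mem_coe, Subgroup.coe_mul_of_left_le_normalizer_right _ _
    ((parabolic_perp_le_centralizer cs Θ).trans (Subgroup.centralizer_le_normalizer _))] at hk
  exact Set.mem_mul.mp hk

/-! ### The decompositions -/

lemma injOn_minRight_mul_parabolic {J K : Set B} (h : J ⊆ K) :
    Set.InjOn (fun p : W × W => p.1 * p.2) (minRight cs K ×ˢ (parabolic cs J : Set W)) := by
  rintro ⟨a, b⟩ ⟨ha, hb⟩ ⟨a', b'⟩ ⟨ha', hb'⟩ heq
  dsimp only at ha hb ha' hb' heq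
  have hv : b * b'⁻¹ ∈ parabolic cs K := parabolic_mono cs h (mul_mem hb (inv_mem hb'))
  have ha'eq : a * (b * b'⁻¹) = a' := by rw [← mul_assoc, heq, mul_inv_cancel_right]
  have h₁ := ha _ hv
  have h₂ := ha' _ (inv_mem hv)
  rw [← ha'eq, mul_inv_cancel_right, h₁, cs.length_inv] at h₂
  have hone : b * b'⁻¹ = 1 := cs.length_eq_zero_iff.mp (by omega)
  rw [hone, mul_one] at ha'eq
  rw [ha'eq, mul_inv_eq_one.mp hone]

lemma image_minRight_mul_parabolic_perp (Θ : Set B) :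
    (fun p : W × W => p.1 * p.2) ''
        (minRight cs (Θ ∪ perp M Θ) ×ˢ (parabolic cs (perp M Θ) : Set W)) = minRight cs Θ := by
  have hΘ : parabolic cs Θ ≤ parabolic cs (Θ ∪ perp M Θ) :=
    parabolic_mono cs Set.subset_union_left
  have hperp : parabolic cs (perp M Θ) ≤ parabolic cs (Θ ∪ perp M Θ) :=
    parabolic_mono cs Set.subset_union_right
  have hadd := parabolic_subset_minRight_of_disjoint cs (disjoint_perp M Θ)
  refine Set.Subset.antisymm ?_ fun w hw => ?_
  · rintro _ ⟨⟨a, b⟩, ⟨ha, hb⟩, rfl⟩ u hu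
    dsimp only at ha hb ⊢
    rw [mul_assoc, ha _ (mul_mem (hperp hb) (hΘ hu)), hadd hb u hu, ha _ (hperp hb), add_assoc]
  · obtain ⟨a, ha, k, hk, rfl⟩ := exists_minRight_mul_parabolic cs (Θ ∪ perp M Θ) w
    obtain ⟨b, hb, u, hu, rfl⟩ := exists_mul_of_mem_parabolic_union_perp cs hk
    have h := hw _ (inv_mem hu)
    rw [ha _ hk, mul_assoc, mul_inv_cancel_right, ha _ (hperp hb), hadd hb u hu,
      cs.length_inv] at h
    have hone : u = 1 := cs.length_eq_zero_iff.mp (by omega)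
    exact ⟨(a, b), ⟨ha, hb⟩, by simp [hone]⟩

lemma inv_mem_minRight_iff {J : Set B} {w : W} : w⁻¹ ∈ minRight cs J ↔ w ∈ minLeft cs J := by
  refine ⟨fun h u hu => ?_, fun h u hu => ?_⟩
  · have := h _ (inv_mem hu)
    rwa [← mul_inv_rev, cs.length_inv, cs.length_inv, cs.length_inv, add_comm] at this
  · have := h _ (inv_mem hu)
    rw [← cs.length_inv, mul_inv_rev, inv_inv, cs.length_inv u] at this
    rw [this, cs.length_inv, add_comm]

/-- the multiplication maps `W^{Θ∪Θ^⊥} × W_{Θ^⊥} → W` and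
`W_{Θ^⊥} × ^{Θ∪Θ^⊥}W → W` are injective with images `W^Θ` and `^ΘW` respectively. -/
theorem statement0 [Finite B] (Θ : Set B) :
    (Set.InjOn (fun p : W × W => p.1 * p.2)
        ((minRight cs (Θ ∪ perp M Θ)) ×ˢ ((parabolic cs (perp M Θ) : Set W))) ∧
      (fun p : W × W => p.1 * p.2) ''
          ((minRight cs (Θ ∪ perp M Θ)) ×ˢ ((parabolic cs (perp M Θ) : Set W)))
        = minRight cs Θ) ∧
    (Set.InjOn (fun p : W × W => p.1 * p.2)
        (((parabolic cs (perp M Θ) : Set W)) ×ˢ (minLeft cs (Θ ∪ perp M Θ))) ∧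
      (fun p : W × W => p.1 * p.2) ''
          (((parabolic cs (perp M Θ) : Set W)) ×ˢ (minLeft cs (Θ ∪ perp M Θ)))
        = minLeft cs Θ) := by
  have hinj := injOn_minRight_mul_parabolic cs (Set.subset_union_right (s := Θ) (t := perp M Θ))
  have himage := image_minRight_mul_parabolic_perp cs Θ
  refine ⟨⟨hinj, himage⟩, ?_, ?_⟩
  · rintro ⟨b, c⟩ ⟨hb, hc⟩ ⟨b', c'⟩ ⟨hb', hc'⟩ heq
    have := @hinj (c⁻¹, b⁻¹)
      ⟨(inv_mem_minRight_iff cs).mpr hc, inv_mem hb⟩ (c'⁻¹, b'⁻¹)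
      ⟨(inv_mem_minRight_iff cs).mpr hc', inv_mem hb'⟩
      (by simpa only [mul_inv_rev] using congrArg (·⁻¹) heq)
    simp only [Prod.mk.injEq, inv_inj] at this
    rw [this.1, this.2]
  · ext w
    rw [← inv_mem_minRight_iff, ← himage]
    constructor
    · rintro ⟨⟨b, c⟩, ⟨hb, hc⟩, rfl⟩
      exact ⟨(c⁻¹, b⁻¹), ⟨(inv_mem_minRight_iff cs).mpr hc, inv_mem hb⟩, by simp⟩
    · rintro ⟨⟨a, b⟩, ⟨ha, hb⟩, hw⟩
      refine ⟨(b⁻¹, a⁻¹), ⟨inv_mem hb, (inv_mem_minRight_iff cs).mp (by simpa using ha)⟩, ?_⟩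
      simpa only [mul_inv_rev, inv_inv] using congrArg (·⁻¹) hw

end Paper
end

section
/- Let Θ ⊆ I. Define a relation R on the set of pairs (w₁, w₂) with w₁ ∈ W^Θ, w₂ ∈ ^{Θ∪Θ^⊥}W by: (w₁,w₂) R (w₁',w₂') iff there exists w ∈ W_{Θ^⊥} with w₁ ≤ w₁'w and w₂ ≥ w⁻¹w₂' in the Bruhat order. Then for every finite sequence c₀, c₁, …, c_k of such pairs with c_j R c_{j+1} and c_j ≠ c_{j+1} for all 0 ≤ j < k, one has k ≤ (ℓ(w₁') − ℓ(w₂')) − (ℓ(w₁) − ℓ(w₂)), where (w₁,w₂) = c₀ and (w₁',w₂') = c_k. In particular, every such chain joining two fixed pairs is finite. -/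
open Classical

namespace Paper

variable {B : Type*} {M : CoxeterMatrix B} {W : Type*} [Group W]

variable (cs : CoxeterSystem M W)

theorem bruhatLE.length_le_and_eq {cs : CoxeterSystem M W} {x y : W} (h : bruhatLE cs x y) :
    cs.length x ≤ cs.length y ∧ (cs.length x = cs.length y → x = y) := by
  induction h with
  | refl => exact ⟨le_rfl, fun _ => rfl⟩
  | tail _ hbc ih =>
    obtain ⟨_, _, _, hlt⟩ := hbc
    exact ⟨by omega, fun _ => by omega⟩

/-- A non-trivial step of the extended Bruhat order strictly increases the extended length. -/
theorem extendedLength_add_one_le {Θ : Set B} {p q : W × W}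
    (hp : p.2 ∈ minLeft cs (Θ ∪ perp M Θ)) (hq : q.2 ∈ minLeft cs (Θ ∪ perp M Θ))
    (hR : ∃ w ∈ parabolic cs (perp M Θ),
      bruhatLE cs p.1 (q.1 * w) ∧ bruhatLE cs (w⁻¹ * q.2) p.2)
    (hne : p ≠ q) :
    (cs.length p.1 : ℤ) - cs.length p.2 + 1 ≤ (cs.length q.1 : ℤ) - cs.length q.2 := by
  obtain ⟨w, hw, h₁, h₂⟩ := hR
  have hw' : w ∈ parabolic cs (Θ ∪ perp M Θ) :=
    Subgroup.closure_mono (Set.image_mono Set.subset_union_right) hw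
  have hq₂ := hq _ (inv_mem hw')
  rw [cs.length_inv] at hq₂
  have hmul := cs.length_mul_le q.1 w
  have hle₁ := h₁.length_le_and_eq.1
  have hle₂ := h₂.length_le_and_eq.1
  by_contra hlt
  have h₁eq : p.1 = q.1 * w := h₁.length_le_and_eq.2 (by omega)
  have h₂eq : w⁻¹ * q.2 = p.2 := h₂.length_le_and_eq.2 (by omega)
  have hp₂ := hp _ hw'
  rw [← h₂eq, mul_inv_cancel_left] at hp₂
  have hw₁ : w = 1 := cs.length_eq_zero_iff.1 (by omega)
  subst hw₁
  exact hne (Prod.ext (by simpa using h₁eq) (by simpa using h₂eq.symm))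

/-- any strict chain `c₀ R c₁ R … R c_k` of normal form I pairs for
the extended Bruhat order `≤₊₊` has length at most the difference of the
extended lengths `l₊₊` of its endpoints. -/
theorem statement12 [Finite B] (Θ : Set B) (k : ℕ) (c : ℕ → W × W)
    (hNF : ∀ j ≤ k, (c j).1 ∈ minRight cs Θ ∧ (c j).2 ∈ minLeft cs (Θ ∪ perp M Θ))
    (hR : ∀ j < k, ∃ w ∈ parabolic cs (perp M Θ),
        bruhatLE cs (c j).1 ((c (j+1)).1 * w) ∧ bruhatLE cs (w⁻¹ * (c (j+1)).2) (c j).2)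
    (hne : ∀ j < k, c j ≠ c (j+1)) :
    (k : ℤ) ≤ ((cs.length (c k).1 : ℤ) - cs.length (c k).2)
      - ((cs.length (c 0).1 : ℤ) - cs.length (c 0).2) := by
  induction k with
  | zero => simp
  | succ k ih =>
    have hk := ih (fun j hj => hNF j (by omega)) (fun j hj => hR j (by omega))
      (fun j hj => hne j (by omega))
    have hstep := extendedLength_add_one_le cs (hNF k (by omega)).2 (hNF (k + 1) le_rfl).2
      (hR k (by omega)) (hne k (by omega))
    push_cast
    omega

end Paper
end
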